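/- arXiv:0812.5099 — 4 statements merged into one kernel-verified Lean document; each statement's English description precedes it below -/
import Mathlib

section
/- The canonical A-linear map V₀ ⊗_A W₀ → V₀ ⊗_A W, induced by the identity on V₀ and the inclusion W₀ ↪ W (so that v ⊗ w ↦ v ⊗ w), is bijective, i.e. an isomorphism of A-modules. -/
open scoped TensorProduct

theorem aux_add {A M : Type*} [CommRing A] [AddCommGroup M] [Module A M] (B : Ideal A)
    (hB : ∀ b₁ ∈ B, ∀ b₂ ∈ B, ∃ c ∈ B, c * b₁ = b₁ ∧ c * b₂ = b₂) (x y : M)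
    (hx : ∃ c ∈ B, c • x = x) (hy : ∃ c ∈ B, c • y = y) : ∃ c ∈ B, c • (x + y) = x + y := by
  obtain ⟨a, ha, hx⟩ := hx
  obtain ⟨b, hb, hy⟩ := hy
  obtain ⟨c, hc, h1, h2⟩ := hB a ha b hb
  refine ⟨c, hc, ?_⟩
  have e1 : c • x = x := by rw [← hx, smul_smul, h1]
  have e2 : c • y = y := by rw [← hy, smul_smul, h2]
  rw [smul_add, e1, e2]

theorem aux_V {A V : Type*} [CommRing A] [AddCommGroup V] [Module A V] (B : Ideal A)
    (hB : ∀ b₁ ∈ B, ∀ b₂ ∈ B, ∃ c ∈ B, c * b₁ = b₁ ∧ c * b₂ = b₂) (x : V)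
    (hx : x ∈ B • (⊤ : Submodule A V)) : ∃ c ∈ B, c • x = x := by
  induction hx using Submodule.smul_induction_on' with
  | smul r hr n hn =>
    obtain ⟨c, hc, h, -⟩ := hB r hr r hr
    exact ⟨c, hc, by rw [smul_smul, h]⟩
  | add x hx y hy h1 h2 => exact aux_add B hB x y h1 h2

theorem aux_T {A V N : Type*} [CommRing A] [AddCommGroup V] [Module A V]
    [AddCommGroup N] [Module A N] (B : Ideal A)
    (hB : ∀ b₁ ∈ B, ∀ b₂ ∈ B, ∃ c ∈ B, c * b₁ = b₁ ∧ c * b₂ = b₂)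
    (t : ↥(B • (⊤ : Submodule A V)) ⊗[A] N) : ∃ c ∈ B, c • t = t := by
  induction t using TensorProduct.induction_on with
  | zero => exact ⟨0, B.zero_mem, by simp⟩
  | tmul x n =>
    obtain ⟨c, hc, h⟩ := aux_V B hB x.1 x.2
    refine ⟨c, hc, ?_⟩
    have h' : c • x = x := Subtype.ext h
    rw [TensorProduct.smul_tmul', h']
  | add x y h1 h2 => exact aux_add B hB x y h1 h2

/-- Let `B` be an ideal of `A` such that for any `b₁, b₂ ∈ B` there exists `c ∈ B` with
`c * b₁ = b₁` and `c * b₂ = b₂`, and let `V₀ := B • V`, `W₀ := B • W`.  Then the canonical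
`A`-linear map `V₀ ⊗[A] W₀ → V₀ ⊗[A] W`, induced by the identity on `V₀` and the inclusion
`W₀ ↪ W` (so `v ⊗ w ↦ v ⊗ w`), is bijective. -/
theorem statement3 (K A V W : Type*) [Field K] [CommRing A] [Algebra K A]
    [AddCommGroup V] [Module A V] [Module K V] [IsScalarTower K A V]
    [AddCommGroup W] [Module A W] [Module K W] [IsScalarTower K A W]
    (B : Ideal A)
    (hB : ∀ b₁ ∈ B, ∀ b₂ ∈ B, ∃ c ∈ B, c * b₁ = b₁ ∧ c * b₂ = b₂) :
    Function.Bijective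
      ⇑(TensorProduct.map
          (LinearMap.id :
            ↥(B • (⊤ : Submodule A V)) →ₗ[A] ↥(B • (⊤ : Submodule A V)))
          (B • (⊤ : Submodule A W)).subtype) := by
  have key : ∀ c ∈ B, ∃ g : W →ₗ[A] ↥(B • (⊤ : Submodule A W)), ∀ w, (g w : W) = c • w :=
    fun c hc => ⟨(LinearMap.lsmul A W c).codRestrict _
      (fun w => Submodule.smul_mem_smul hc Submodule.mem_top), fun w => rfl⟩
  constructor
  · rw [injective_iff_map_eq_zero]
    intro t ht
    obtain ⟨c, hc, h⟩ := aux_T B hB t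
    obtain ⟨g, hg⟩ := key c hc
    have e : (TensorProduct.map LinearMap.id g) ∘ₗ (TensorProduct.map
          (LinearMap.id :
            ↥(B • (⊤ : Submodule A V)) →ₗ[A] ↥(B • (⊤ : Submodule A V)))
          (B • (⊤ : Submodule A W)).subtype) = c • LinearMap.id := by
      apply TensorProduct.ext'
      intro x y
      have : g y = c • y := Subtype.ext (hg y)
      simp [this]
    have e' := LinearMap.congr_fun e t
    rw [LinearMap.comp_apply, ht, map_zero] at e'
    rw [← h]
    exact e'.symm
  · intro s
    obtain ⟨c, hc, h⟩ := aux_T B hB s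
    obtain ⟨g, hg⟩ := key c hc
    have e : (TensorProduct.map
          (LinearMap.id :
            ↥(B • (⊤ : Submodule A V)) →ₗ[A] ↥(B • (⊤ : Submodule A V)))
          (B • (⊤ : Submodule A W)).subtype) ∘ₗ (TensorProduct.map LinearMap.id g)
          = c • LinearMap.id := by
      apply TensorProduct.ext'
      intro x y
      simp [hg]
    exact ⟨TensorProduct.map LinearMap.id g s, (LinearMap.congr_fun e s).trans h⟩
end

section
/- There exists an isomorphism of A-modules V₀ ⊗_A W ≅ V ⊗_A W₀ which maps v ⊗ w to v ⊗ w for every v ∈ V₀ and every w ∈ W₀ (elements being regarded in the respective ambient modules via the inclusions V₀ ↪ V and W₀ ↪ W). -/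
open scoped TensorProduct

theorem aux_unit {A V : Type*} [CommRing A] [AddCommGroup V] [Module A V] (B : Ideal A)
    (hB : ∀ b₁ ∈ B, ∀ b₂ ∈ B, ∃ c ∈ B, c * b₁ = b₁ ∧ c * b₂ = b₂)
    (v : V) (hv : v ∈ B • (⊤ : Submodule A V)) : ∃ c ∈ B, c • v = v := by
  induction hv using Submodule.smul_induction_on' with
  | smul b hb n hn =>
    obtain ⟨c, hc, h, -⟩ := hB b hb b hb
    exact ⟨c, hc, by rw [smul_smul, h]⟩
  | add x hx y hy h1 h2 =>
    obtain ⟨c1, hc1, h1⟩ := h1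
    obtain ⟨c2, hc2, h2⟩ := h2
    obtain ⟨c, hc, e1, e2⟩ := hB c1 hc1 c2 hc2
    refine ⟨c, hc, ?_⟩
    rw [smul_add]
    nth_rewrite 1 [← h1, ← h2]
    rw [smul_smul, smul_smul, e1, e2, h1, h2]

theorem aux_equiv {A M W : Type*} [CommRing A] [AddCommGroup M] [Module A M]
    [AddCommGroup W] [Module A W] (B : Ideal A)
    (hB : ∀ b₁ ∈ B, ∀ b₂ ∈ B, ∃ c ∈ B, c * b₁ = b₁ ∧ c * b₂ = b₂)
    (hM : ∀ m : M, ∃ c ∈ B, c • m = m) :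
    ∃ e : (M ⊗[A] ↥(B • (⊤ : Submodule A W))) ≃ₗ[A] (M ⊗[A] W),
      ∀ m w, e (m ⊗ₜ[A] w) = m ⊗ₜ[A] (w : W) := by
  choose u hu hum using hM
  let s : M → W → ↥(B • (⊤ : Submodule A W)) := fun m w =>
    ⟨u m • w, Submodule.smul_mem_smul (hu m) trivial⟩
  have key : ∀ (m : M) (w : W) (c : A) (hc : c ∈ B), c • m = m →
      m ⊗ₜ[A] s m w = m ⊗ₜ[A]
        (⟨c • w, Submodule.smul_mem_smul hc trivial⟩ : ↥(B • (⊤ : Submodule A W))) := by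
    intro m w c hc h
    have e : c • s m w = u m •
        (⟨c • w, Submodule.smul_mem_smul hc trivial⟩ : ↥(B • (⊤ : Submodule A W))) :=
      Subtype.ext (smul_comm c (u m) w)
    calc m ⊗ₜ[A] s m w = (c • m) ⊗ₜ[A] s m w := by rw [h]
      _ = _ := by rw [TensorProduct.smul_tmul, e, ← TensorProduct.smul_tmul, hum]
  let g : M →ₗ[A] W →ₗ[A] (M ⊗[A] ↥(B • (⊤ : Submodule A W))) :=
    LinearMap.mk₂ A (fun m w => m ⊗ₜ[A] s m w)
      (by
        intro m n w
        obtain ⟨c, hc, e1, e2⟩ := hB _ (hu m) _ (hu n)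
        have h1 : c • m = m := by
          nth_rewrite 1 [← hum m]
          rw [smul_smul, e1, hum]
        have h2 : c • n = n := by
          nth_rewrite 1 [← hum n]
          rw [smul_smul, e2, hum]
        rw [key m w c hc h1, key n w c hc h2,
          key (m + n) w c hc (by rw [smul_add, h1, h2]), TensorProduct.add_tmul])
      (by
        intro a m w
        rw [key (a • m) w (u m) (hu m) (by rw [smul_comm, hum]), TensorProduct.smul_tmul'])
      (by
        intro m w w'
        rw [← TensorProduct.tmul_add]
        congr 1
        exact Subtype.ext (smul_add _ _ _))
      (by
        intro a m w
        rw [← TensorProduct.tmul_smul]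
        congr 1
        exact Subtype.ext (smul_comm _ _ _))
  refine ⟨LinearEquiv.ofLinear (LinearMap.lTensor M (Submodule.subtype _))
    (TensorProduct.lift g) ?_ ?_, fun m w => rfl⟩
  · refine TensorProduct.ext' fun m w => ?_
    change m ⊗ₜ[A] (u m • w) = m ⊗ₜ[A] w
    rw [← TensorProduct.smul_tmul, hum]
  · refine TensorProduct.ext' fun m w => ?_
    change m ⊗ₜ[A] (u m • w) = m ⊗ₜ[A] w
    rw [← TensorProduct.smul_tmul, hum]

/-- Let `B` be an ideal of `A` such that for any `b₁, b₂ ∈ B` there exists `c ∈ B` with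
`c * b₁ = b₁` and `c * b₂ = b₂`, and let `V₀ := B • V`, `W₀ := B • W`.  Then there is an
isomorphism of `A`-modules `V₀ ⊗[A] W ≅ V ⊗[A] W₀` mapping `v ⊗ w` to `v ⊗ w` for every
`v ∈ V₀` and `w ∈ W₀` (elements regarded in the ambient modules via the inclusions). -/
theorem statement5 (K A V W : Type*) [Field K] [CommRing A] [Algebra K A]
    [AddCommGroup V] [Module A V] [Module K V] [IsScalarTower K A V]
    [AddCommGroup W] [Module A W] [Module K W] [IsScalarTower K A W]
    (B : Ideal A)
    (hB : ∀ b₁ ∈ B, ∀ b₂ ∈ B, ∃ c ∈ B, c * b₁ = b₁ ∧ c * b₂ = b₂) :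
    ∃ e : (↥(B • (⊤ : Submodule A V)) ⊗[A] W) ≃ₗ[A] (V ⊗[A] ↥(B • (⊤ : Submodule A W))),
      ∀ (v : ↥(B • (⊤ : Submodule A V))) (w : ↥(B • (⊤ : Submodule A W))),
        e (v ⊗ₜ[A] (w : W)) = (v : V) ⊗ₜ[A] w := by
  obtain ⟨f, hf⟩ := aux_equiv (M := ↥(B • (⊤ : Submodule A V))) (W := W) B hB (fun m => by
    obtain ⟨c, hc, h⟩ := aux_unit B hB m.1 m.2
    exact ⟨c, hc, Subtype.ext h⟩)
  obtain ⟨g, hg⟩ := aux_equiv (M := ↥(B • (⊤ : Submodule A W))) (W := V) B hB (fun m => by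
    obtain ⟨c, hc, h⟩ := aux_unit B hB m.1 m.2
    exact ⟨c, hc, Subtype.ext h⟩)
  refine ⟨f.symm ≪≫ₗ TensorProduct.comm A _ _ ≪≫ₗ g ≪≫ₗ TensorProduct.comm A _ _, fun v w => ?_⟩
  simp only [LinearEquiv.trans_apply]
  rw [← hf, LinearEquiv.symm_apply_apply, TensorProduct.comm_tmul, hg, TensorProduct.comm_tmul]
end

section
/- If W is faithfully A-generated by θ, then there is a unique K-linear isomorphism Φ from the algebraic dual (V ⊗_A W₀)^* onto the algebraic dual V₀^* such that Φ(u)(b·v) = u(v ⊗ (b·θ)) for all u ∈ (V ⊗_A W₀)^*, b ∈ B and v ∈ V. -/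
open scoped TensorProduct

/-- Let `B` be an ideal of `A` such that for any `b₁, b₂ ∈ B` there exists `c ∈ B` with
`c * b₁ = b₁` and `c * b₂ = b₂`, and let `V₀ := B • V`, `W₀ := B • W`.  If `W` is faithfully
`A`-generated by `θ` (i.e. `a ↦ a • θ` is a bijection `A → W`), then there is a unique
`K`-linear isomorphism `Φ : (V ⊗[A] W₀)^* ≃ V₀^*` such that
`Φ u (b • v) = u (v ⊗ (b • θ))` for all `u`, all `b ∈ B` and all `v ∈ V`. -/
theorem statement7 (K A V W : Type*) [Field K] [CommRing A] [Algebra K A]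
    [AddCommGroup V] [Module A V] [Module K V] [IsScalarTower K A V]
    [AddCommGroup W] [Module A W] [Module K W] [IsScalarTower K A W]
    (B : Ideal A)
    (hB : ∀ b₁ ∈ B, ∀ b₂ ∈ B, ∃ c ∈ B, c * b₁ = b₁ ∧ c * b₂ = b₂)
    (θ : W) (hθ : Function.Bijective fun a : A => a • θ) :
    ∃! Φ : Module.Dual K (V ⊗[A] ↥(B • (⊤ : Submodule A W))) ≃ₗ[K]
        Module.Dual K ↥(B • (⊤ : Submodule A V)),
      ∀ (u : Module.Dual K (V ⊗[A] ↥(B • (⊤ : Submodule A W)))) (b : A) (hb : b ∈ B) (v : V),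
        Φ u ⟨b • v, Submodule.smul_mem_smul hb Submodule.mem_top⟩ =
          u (v ⊗ₜ[A]
            (⟨b • θ, Submodule.smul_mem_smul hb Submodule.mem_top⟩ :
              ↥(B • (⊤ : Submodule A W)))) := by
  classical
  let g : W ≃ₗ[A] A := (LinearEquiv.ofBijective (LinearMap.toSpanSingleton A W θ) hθ).symm
  have hg : ∀ a : A, g (a • θ) = a := fun a =>
    (LinearEquiv.ofBijective (LinearMap.toSpanSingleton A W θ) hθ).symm_apply_apply a
  have hgs : ∀ w : W, g w • θ = w := fun w =>
    (LinearEquiv.ofBijective (LinearMap.toSpanSingleton A W θ) hθ).apply_symm_apply w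
  have hgB : ∀ w ∈ B • (⊤ : Submodule A W), g w ∈ B := by
    intro w hw
    refine Submodule.smul_induction_on hw ?_ ?_
    · intro b hb n _
      rw [map_smul, smul_eq_mul]
      exact B.mul_mem_right _ hb
    · intro x y hx hy
      rw [map_add]
      exact B.add_mem hx hy
  let W₀ := B • (⊤ : Submodule A W)
  let V₀ := B • (⊤ : Submodule A V)
  let τ : ∀ b : A, b ∈ B → W₀ := fun b hb =>
    ⟨b • θ, Submodule.smul_mem_smul hb Submodule.mem_top⟩
  let f : V ⊗[A] W₀ →ₗ[A] V :=
    TensorProduct.lift ((LinearMap.lsmul A V).flip.compl₂ (g.toLinearMap ∘ₗ W₀.subtype))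
  have hf : ∀ (v : V) (w : W₀), f (v ⊗ₜ[A] w) = g (w : W) • v := by
    intro v w
    simp [f]
  have key : ∀ t : V ⊗[A] W₀, ∃ (c : A) (hc : c ∈ B) (v : V), c • v = v ∧ t = v ⊗ₜ[A] τ c hc := by
    have mv : ∀ (b : A) (hb : b ∈ B) (c : A) (hc : c ∈ B) (v : V), c * b = b →
        v ⊗ₜ[A] τ b hb = (b • v) ⊗ₜ[A] τ c hc := by
      intro b hb c hc v h
      rw [TensorProduct.smul_tmul]
      congr 1
      apply Subtype.ext
      change b • θ = b • c • θ
      rw [smul_smul, mul_comm, h]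
    intro t
    induction t using TensorProduct.induction_on with
    | zero => exact ⟨0, B.zero_mem, 0, by simp, by simp⟩
    | tmul v w =>
      have hb := hgB w w.2
      obtain ⟨c, hc, h, -⟩ := hB _ hb _ hb
      refine ⟨c, hc, g (w : W) • v, by rw [smul_smul, h], ?_⟩
      rw [← mv _ hb c hc v h]
      congr 1
      exact Subtype.ext (hgs w).symm
    | add x y hx hy =>
      obtain ⟨c, hc, v, hv, rfl⟩ := hx
      obtain ⟨c', hc', v', hv', rfl⟩ := hy
      obtain ⟨d, hd, h, h'⟩ := hB _ hc _ hc'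
      refine ⟨d, hd, c • v + c' • v', ?_, ?_⟩
      · rw [smul_add, smul_smul, smul_smul, h, h']
      · rw [mv c hc d hd v h, mv c' hc' d hd v' h', TensorProduct.add_tmul]
  have hfV : ∀ t, f t ∈ V₀ := by
    intro t
    obtain ⟨c, hc, v, hv, rfl⟩ := key t
    rw [hf]
    exact Submodule.smul_mem_smul (hgB _ (τ c hc).2) Submodule.mem_top
  have hbij : Function.Bijective (f.codRestrict V₀ hfV) := by
    constructor
    · rw [injective_iff_map_eq_zero]
      intro t ht
      have ht' : f t = 0 := congrArg Subtype.val ht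
      obtain ⟨c, hc, v, hv, rfl⟩ := key t
      rw [hf] at ht'
      change g (c • θ) • v = 0 at ht'
      rw [hg, hv] at ht'
      rw [ht', TensorProduct.zero_tmul]
    · have : V₀ ≤ LinearMap.range f := by
        refine Submodule.smul_le.2 ?_
        intro b hb v _
        refine ⟨v ⊗ₜ[A] τ b hb, ?_⟩
        rw [hf]
        change g (b • θ) • v = _
        rw [hg]
      rintro ⟨x, hx⟩
      obtain ⟨t, ht⟩ := this hx
      exact ⟨t, Subtype.ext ht⟩
  let e : (V ⊗[A] W₀) ≃ₗ[A] V₀ := LinearEquiv.ofBijective _ hbij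
  have he : ∀ (b : A) (hb : b ∈ B) (v : V), e (v ⊗ₜ[A] τ b hb) =
      ⟨b • v, Submodule.smul_mem_smul hb Submodule.mem_top⟩ := by
    intro b hb v
    apply Subtype.ext
    change f _ = b • v
    rw [hf]
    change g (b • θ) • v = _
    rw [hg]
  refine ⟨(e.restrictScalars K).symm.dualMap, ?_, ?_⟩
  · intro u b hb v
    change u (e.symm _) = u (v ⊗ₜ[A] τ b hb)
    rw [← he b hb v, e.symm_apply_apply]
  · intro Ψ hΨ
    ext u x
    obtain ⟨t, rfl⟩ := e.surjective x
    change _ = u (e.symm (e t))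
    rw [e.symm_apply_apply]
    obtain ⟨c, hc, v, hv, rfl⟩ := key t
    rw [he c hc v]
    exact hΨ u c hc v
end

section
/- There is a unique A-module isomorphism Φ from the algebraic dual (V ⊗_A W₀)^* onto L_A(V₀, W^*) such that Φ(u)(b·v)(w) = u(v ⊗ (b·w)) for all u ∈ (V ⊗_A W₀)^*, b ∈ B, v ∈ V and w ∈ W. -/
open scoped TensorProduct

variable (K A : Type*) [Field K] [CommRing A] [Algebra K A]

/-- Scalar multiplication by `a : A` as a `K`-linear map on an `A`-module. -/
def smulKLinear (M : Type*) [AddCommGroup M] [Module A M] [Module K M] [IsScalarTower K A M]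
    (a : A) : M →ₗ[K] M where
  toFun m := a • m
  map_add' := smul_add a
  map_smul' k m := (smul_comm k a m).symm

/-- The algebraic dual `M^* = Hom_K(M, K)` of an `A`-module `M` is an `A`-module via the
adjoint action `(a • f) m := f (a • m)`. -/
instance dualModule (M : Type*) [AddCommGroup M] [Module A M] [Module K M]
    [IsScalarTower K A M] : Module A (Module.Dual K M) where
  smul a f := f ∘ₗ smulKLinear K A M a
  one_smul f := LinearMap.ext fun m => by
    show f ((1 : A) • m) = f m
    rw [one_smul]
  mul_smul a b f := LinearMap.ext fun m => by
    show f ((a * b) • m) = f (b • a • m)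
    rw [← mul_smul, mul_comm]
  smul_zero a := LinearMap.ext fun _ => rfl
  smul_add a f g := LinearMap.ext fun _ => rfl
  add_smul a b f := LinearMap.ext fun m => by
    show f ((a + b) • m) = f (a • m) + f (b • m)
    rw [add_smul, map_add]
  zero_smul f := LinearMap.ext fun m => by
    show f ((0 : A) • m) = 0
    rw [zero_smul, map_zero]


section aux
variable {A}
variable {V W : Type*} [AddCommGroup V] [Module A V] [AddCommGroup W] [Module A W]

/-- membership of `b • w` in `B W` -/
def mkSm (B : Ideal A) (W : Type*) [AddCommGroup W] [Module A W] (b : A) (hb : b ∈ B) :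
    W →ₗ[A] ↥(B • (⊤ : Submodule A W)) where
  toFun w := ⟨b • w, Submodule.smul_mem_smul hb Submodule.mem_top⟩
  map_add' x y := Subtype.ext (smul_add b x y)
  map_smul' a x := Subtype.ext (smul_comm b a x)

lemma exists_unit_one (B : Ideal A)
    (hB : ∀ b₁ ∈ B, ∀ b₂ ∈ B, ∃ c ∈ B, c * b₁ = b₁ ∧ c * b₂ = b₂)
    (x : V) (hx : x ∈ B • (⊤ : Submodule A V)) : ∃ c ∈ B, c • x = x := by
  refine Submodule.smul_induction_on hx ?_ ?_
  · intro r hr n _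
    obtain ⟨c, hc, h, -⟩ := hB r hr r hr
    exact ⟨c, hc, by rw [smul_smul, h]⟩
  · intro x y hx hy
    obtain ⟨c, hc, h1⟩ := hx
    obtain ⟨d, hd, h2⟩ := hy
    obtain ⟨e, he, h3, h4⟩ := hB c hc d hd
    refine ⟨e, he, ?_⟩
    rw [smul_add]
    congr 1
    · rw [← h1, smul_smul, h3]
    · rw [← h2, smul_smul, h4]

lemma exists_unit_two (B : Ideal A)
    (hB : ∀ b₁ ∈ B, ∀ b₂ ∈ B, ∃ c ∈ B, c * b₁ = b₁ ∧ c * b₂ = b₂)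
    (x : ↥(B • (⊤ : Submodule A V))) (y : ↥(B • (⊤ : Submodule A W))) :
    ∃ c ∈ B, c • x = x ∧ c • y = y := by
  obtain ⟨c, hc, h1⟩ := exists_unit_one B hB x.1 x.2
  obtain ⟨d, hd, h2⟩ := exists_unit_one B hB y.1 y.2
  obtain ⟨e, he, h3, h4⟩ := hB c hc d hd
  refine ⟨e, he, Subtype.ext ?_, Subtype.ext ?_⟩
  · show e • x.1 = x.1
    rw [← h1, smul_smul, h3]
  · show e • y.1 = y.1
    rw [← h2, smul_smul, h4]

lemma indep (B : Ideal A) (x : V) (w : W) (c d : A) (hc : c ∈ B) (hd : d ∈ B)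
    (h1 : c • x = x) (h2 : d • x = x) :
    x ⊗ₜ[A] mkSm B W c hc w = x ⊗ₜ[A] mkSm B W d hd w := by
  have e : d • mkSm B W c hc w = c • mkSm B W d hd w :=
    Subtype.ext (smul_comm d c w)
  calc x ⊗ₜ[A] mkSm B W c hc w = (d • x) ⊗ₜ[A] mkSm B W c hc w := by rw [h2]
    _ = (c • x) ⊗ₜ[A] mkSm B W d hd w := by
      rw [TensorProduct.smul_tmul, e, ← TensorProduct.smul_tmul]
    _ = _ := by rw [h1]

lemma exists_alpha (B : Ideal A)
    (hB : ∀ b₁ ∈ B, ∀ b₂ ∈ B, ∃ c ∈ B, c * b₁ = b₁ ∧ c * b₂ = b₂) (V W : Type*)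
    [AddCommGroup V] [Module A V] [AddCommGroup W] [Module A W] :
    ∃ f : (↥(B • (⊤ : Submodule A V)) ⊗[A] W) →ₗ[A] (V ⊗[A] ↥(B • (⊤ : Submodule A W))),
      ∀ (x : ↥(B • (⊤ : Submodule A V))) (w : W) (c : A) (hc : c ∈ B), c • x = x →
        f (x ⊗ₜ w) = x.1 ⊗ₜ mkSm B W c hc w := by
  choose c hc h using fun x : ↥(B • (⊤ : Submodule A V)) => exists_unit_one B hB x.1 x.2
  refine ⟨TensorProduct.lift (LinearMap.mk₂ A (fun x w => x.1 ⊗ₜ mkSm B W (c x) (hc x) w)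
    ?_ ?_ ?_ ?_), ?_⟩
  · intro x y w
    obtain ⟨e, he, h3, h4⟩ := exists_unit_two B hB x y
    have h3' : e • x.1 = x.1 := congrArg Subtype.val h3
    have h4' : e • y.1 = y.1 := congrArg Subtype.val h4
    have h5 : e • (x + y).1 = (x + y).1 := by
      show e • (x.1 + y.1) = x.1 + y.1
      rw [smul_add, h3', h4']
    rw [indep B _ w _ e (hc _) he (h _) h5, indep B _ w _ e (hc x) he (h _) h3',
      indep B _ w _ e (hc y) he (h _) h4', ← TensorProduct.add_tmul]
    rfl
  · intro a x w
    have h5 : c x • (a • x).1 = (a • x).1 := by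
      show c x • (a • x.1) = a • x.1
      rw [smul_comm, h x]
    rw [indep B _ w _ (c x) (hc _) (hc x) (h _) h5]
    rfl
  · intro x w w'
    rw [map_add, TensorProduct.tmul_add]
  · intro a x w
    rw [map_smul, TensorProduct.tmul_smul]
  · intro x w d hd hx
    rw [TensorProduct.lift.tmul, LinearMap.mk₂_apply]
    exact indep B _ w _ d (hc x) hd (h x) (congrArg Subtype.val hx)

lemma exists_alpha_equiv (B : Ideal A)
    (hB : ∀ b₁ ∈ B, ∀ b₂ ∈ B, ∃ c ∈ B, c * b₁ = b₁ ∧ c * b₂ = b₂) (V W : Type*)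
    [AddCommGroup V] [Module A V] [AddCommGroup W] [Module A W] :
    ∃ f : (↥(B • (⊤ : Submodule A V)) ⊗[A] W) ≃ₗ[A] (V ⊗[A] ↥(B • (⊤ : Submodule A W))),
      ∀ (b : A) (hb : b ∈ B) (v : V) (w : W),
        f (mkSm B V b hb v ⊗ₜ w) = v ⊗ₜ mkSm B W b hb w := by
  obtain ⟨f, hf⟩ := exists_alpha B hB V W
  obtain ⟨g', hg'⟩ := exists_alpha B hB W V
  let g := (TensorProduct.comm A W ↥(B • (⊤ : Submodule A V))).toLinearMap ∘ₗ g' ∘ₗ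
    (TensorProduct.comm A V ↥(B • (⊤ : Submodule A W))).toLinearMap
  have hg : ∀ (y : ↥(B • (⊤ : Submodule A W))) (v : V) (c : A) (hc : c ∈ B), c • y = y →
        g (v ⊗ₜ y) = mkSm B V c hc v ⊗ₜ y.1 := by
    intro y v c hc h
    simp [g, hg' y v c hc h]
  refine ⟨LinearEquiv.ofLinearMap f g ?_ ?_, ?_⟩
  · refine TensorProduct.ext' fun v y => ?_
    obtain ⟨c, hc, h, -⟩ := exists_unit_two B hB y y
    obtain ⟨d, hd, hdc, -⟩ := hB c hc c hc
    have e : d • mkSm B V c hc v = mkSm B V c hc v := Subtype.ext (by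
      show d • c • v = c • v
      rw [smul_smul, hdc])
    rw [LinearMap.comp_apply, hg y v c hc h, hf _ _ d hd e]
    show (c • v) ⊗ₜ[A] _ = v ⊗ₜ[A] y
    rw [TensorProduct.smul_tmul]
    congr 1
    refine Subtype.ext ?_
    have h' : c • y.1 = y.1 := congrArg Subtype.val h
    show c • d • y.1 = y.1
    rw [smul_smul, mul_comm, hdc, h']
  · refine TensorProduct.ext' fun x w => ?_
    obtain ⟨c, hc, h, -⟩ := exists_unit_two B hB x x
    obtain ⟨d, hd, hdc, -⟩ := hB c hc c hc
    have e : d • mkSm B W c hc w = mkSm B W c hc w := Subtype.ext (by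
      show d • c • w = c • w
      rw [smul_smul, hdc])
    rw [LinearMap.comp_apply, hf x w c hc h, hg _ _ d hd e]
    show _ ⊗ₜ[A] (c • w) = x ⊗ₜ[A] w
    rw [← TensorProduct.smul_tmul]
    congr 1
    refine Subtype.ext ?_
    have h' : c • x.1 = x.1 := congrArg Subtype.val h
    show c • d • x.1 = x.1
    rw [smul_smul, mul_comm, hdc, h']
  · intro b hb v w
    obtain ⟨d, hd, hdb, -⟩ := hB b hb b hb
    have e : d • mkSm B V b hb v = mkSm B V b hb v := Subtype.ext (by
      show d • b • v = b • v
      rw [smul_smul, hdb])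
    show f _ = _
    rw [hf _ _ d hd e]
    show (b • v) ⊗ₜ[A] _ = _
    rw [TensorProduct.smul_tmul]
    congr 1
    refine Subtype.ext ?_
    show b • d • w = b • w
    rw [smul_smul, mul_comm, hdb]

end aux

section aux2
variable {K A}

lemma dual_smul_apply {M : Type*} [AddCommGroup M] [Module A M] [Module K M]
    [IsScalarTower K A M] (a : A) (f : Module.Dual K M) (m : M) : (a • f) m = f (a • m) := rfl

/-- Any `A`-linear map of `K`-spaces is `K`-linear on tensor products: the currying
equivalence precomposed with an equivalence. -/
def dualCurryMap {M N T : Type*} [AddCommGroup M] [Module A M]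
    [AddCommGroup N] [Module A N] [Module K N] [IsScalarTower K A N]
    [AddCommGroup T] [Module A T] [Module K T] [IsScalarTower K A T]
    (f : (M ⊗[A] N) ≃ₗ[A] T) :
    Module.Dual K T →ₗ[A] (M →ₗ[A] Module.Dual K N) where
  toFun u :=
    { toFun := fun m =>
        { toFun := fun n => u (f (m ⊗ₜ n))
          map_add' := fun n n' => by rw [TensorProduct.tmul_add, map_add, map_add]
          map_smul' := fun k n => by
            rw [← algebraMap_smul A k n, TensorProduct.tmul_smul, map_smul, algebraMap_smul,
              map_smul]
            rfl }
      map_add' := fun m m' => LinearMap.ext fun n => by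
        show u (f ((m + m') ⊗ₜ n)) = u (f (m ⊗ₜ n)) + u (f (m' ⊗ₜ n))
        rw [TensorProduct.add_tmul, map_add, map_add]
      map_smul' := fun a m => LinearMap.ext fun n => by
        show u (f ((a • m) ⊗ₜ n)) = u (f (m ⊗ₜ (a • n)))
        rw [TensorProduct.smul_tmul] }
  map_add' u u' := rfl
  map_smul' a u := LinearMap.ext fun m => LinearMap.ext fun n => by
    show u (a • f (m ⊗ₜ n)) = u (f (m ⊗ₜ (a • n)))
    rw [← map_smul, TensorProduct.tmul_smul]

lemma dualCurryMap_bij {M N T : Type*} [AddCommGroup M] [Module A M]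
    [AddCommGroup N] [Module A N] [Module K N] [IsScalarTower K A N]
    [AddCommGroup T] [Module A T] [Module K T] [IsScalarTower K A T]
    (f : (M ⊗[A] N) ≃ₗ[A] T) : Function.Bijective (dualCurryMap (K := K) f) := by
  constructor
  · intro u u' h
    refine LinearMap.ext fun t => ?_
    obtain ⟨s, rfl⟩ := f.surjective t
    induction s with
    | zero => rw [map_zero, map_zero, map_zero]
    | add x y hx hy => rw [map_add, map_add, map_add, hx, hy]
    | tmul m n => exact LinearMap.congr_fun (LinearMap.congr_fun h m) n
  · intro g
    let h : (M ⊗[A] N) →+ K := TensorProduct.liftAddHom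
      { toFun := fun m => (g m).toAddMonoidHom
        map_zero' := by rw [map_zero]; rfl
        map_add' := fun m m' => by rw [map_add]; rfl }
      (fun a m n => by
        show g (a • m) n = g m (a • n)
        rw [map_smul]; rfl)
    have hh : ∀ m n, h (m ⊗ₜ n) = g m n := fun m n => rfl
    clear_value h
    have hk : ∀ (k : K) s, h (algebraMap K A k • s) = k • h s := by
      intro k s
      induction s with
      | zero => rw [smul_zero, map_zero, smul_zero]
      | add x y hx hy => rw [smul_add, map_add, map_add, hx, hy, smul_add]
      | tmul m n =>
        rw [← TensorProduct.tmul_smul, algebraMap_smul, hh, hh, map_smul]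
    refine ⟨{ toFun := fun t => h (f.symm t)
              map_add' := fun t t' => by rw [map_add, map_add]
              map_smul' := fun k t => by
                rw [← algebraMap_smul A k t, map_smul, hk]; rfl }, ?_⟩
    refine LinearMap.ext fun m => LinearMap.ext fun n => ?_
    show h (f.symm (f (m ⊗ₜ n))) = g m n
    rw [LinearEquiv.symm_apply_apply, hh]

end aux2

/-- Let `B` be an ideal of `A` such that for any `b₁, b₂ ∈ B` there exists `c ∈ B` with
`c * b₁ = b₁` and `c * b₂ = b₂`, and let `V₀ := B • V`, `W₀ := B • W`.  There is a unique
`A`-module isomorphism `Φ : (V ⊗[A] W₀)^* ≃ L_A(V₀, W^*)` such that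
`Φ u (b • v) w = u (v ⊗ (b • w))` for all `u`, `b ∈ B`, `v ∈ V` and `w ∈ W`. -/
theorem statement8 (V W : Type*)
    [AddCommGroup V] [Module A V] [Module K V] [IsScalarTower K A V]
    [AddCommGroup W] [Module A W] [Module K W] [IsScalarTower K A W]
    (B : Ideal A)
    (hB : ∀ b₁ ∈ B, ∀ b₂ ∈ B, ∃ c ∈ B, c * b₁ = b₁ ∧ c * b₂ = b₂) :
    ∃! Φ : Module.Dual K (V ⊗[A] ↥(B • (⊤ : Submodule A W))) ≃ₗ[A]
        (↥(B • (⊤ : Submodule A V)) →ₗ[A] Module.Dual K W),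
      ∀ (u : Module.Dual K (V ⊗[A] ↥(B • (⊤ : Submodule A W))))
        (b : A) (hb : b ∈ B) (v : V) (w : W),
        Φ u ⟨b • v, Submodule.smul_mem_smul hb Submodule.mem_top⟩ w =
          u (v ⊗ₜ[A]
            (⟨b • w, Submodule.smul_mem_smul hb Submodule.mem_top⟩ :
              ↥(B • (⊤ : Submodule A W)))) := by
  obtain ⟨f, hf⟩ := exists_alpha_equiv B hB V W
  refine ⟨LinearEquiv.ofBijective (dualCurryMap f) (dualCurryMap_bij f), ?_, ?_⟩
  · intro u b hb v w
    exact congrArg u (hf b hb v w)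
  · intro Ψ hΨ
    refine LinearEquiv.ext fun u => LinearMap.ext fun x => LinearMap.ext fun w => ?_
    obtain ⟨c, hc, h⟩ := exists_unit_one B hB x.1 x.2
    have e : x = ⟨c • x.1, Submodule.smul_mem_smul hc Submodule.mem_top⟩ := Subtype.ext h.symm
    rw [e, hΨ u c hc x.1 w]
    exact (congrArg u (hf c hc x.1 w)).symm
end
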